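/- arXiv:1507.02250 — 6 statements merged into one kernel-verified Lean document; each statement's English description precedes it below -/
import Mathlib

section
/- Let P be a real symmetric positive definite n×n matrix and define |x|_P = √(xᵀPx) for x ∈ ℝⁿ. Let f_k : ℝⁿ → ℝⁿ be differentiable for each k ∈ ℕ with Jacobian matrix F_k(x), and let C ⊆ ℝⁿ be a convex forward invariant set for x_{k+1} = f_k(x_k). If α ≥ 0 and F_k(x)ᵀ P F_k(x) ⪯ α² P (in the Loewner order) for all x ∈ C and all k ∈ ℕ, then for every k₀ and every x₀, x̃₀ ∈ C, the trajectories satisfy |φ(k;k₀,x₀) − φ(k;k₀,x̃₀)|_P ≤ α^{k−k₀} |x₀ − x̃₀|_P for all k ≥ k₀. -/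
open Matrix

/-- One-step estimate via the scalar mean value theorem. -/
theorem one_step_aux {n : ℕ} (P : Matrix (Fin n) (Fin n) ℝ) (hP : P.PosDef)
    (f : (Fin n → ℝ) → (Fin n → ℝ))
    (F : (Fin n → ℝ) → Matrix (Fin n) (Fin n) ℝ)
    (hF : ∀ x, HasFDerivAt f ((F x).mulVecLin.toContinuousLinearMap) x)
    (C : Set (Fin n → ℝ)) (hC : Convex ℝ C) (α : ℝ)
    (hLMI : ∀ x ∈ C, ((α ^ 2 • P) - (F x)ᵀ * P * (F x)).PosSemidef)
    (x y : Fin n → ℝ) (hx : x ∈ C) (hy : y ∈ C) :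
    (f x - f y) ⬝ᵥ P.mulVec (f x - f y) ≤ α ^ 2 * ((x - y) ⬝ᵥ P.mulVec (x - y)) := by
  set d := f x - f y with hd
  set w := x - y with hw
  let L : (Fin n → ℝ) →L[ℝ] ℝ :=
    LinearMap.toContinuousLinearMap ((dotProductBilin ℝ ℝ d).comp P.mulVecLin)
  have hL : ∀ v, L v = d ⬝ᵥ P.mulVec v := fun v => rfl
  have hline : ∀ t : ℝ, HasDerivAt (fun t : ℝ => y + t • w) w t := by
    intro t
    simpa using ((hasDerivAt_id t).smul_const w).const_add y
  have hder : ∀ t : ℝ, HasDerivAt (fun t : ℝ => L (f (y + t • w)))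
      (L ((F (y + t • w)).mulVec w)) t := by
    intro t
    have h1 := (hF (y + t • w)).comp_hasDerivAt t (hline t)
    exact L.hasFDerivAt.comp_hasDerivAt t h1
  obtain ⟨t, ht, hte⟩ := exists_hasDerivAt_eq_slope (fun t : ℝ => L (f (y + t • w)))
    (fun t => L ((F (y + t • w)).mulVec w)) (zero_lt_one)
    (fun t _ => (hder t).continuousAt.continuousWithinAt) (fun t _ => hder t)
  have hz : y + t • w ∈ C := hC.add_smul_sub_mem hy hx ⟨ht.1.le, ht.2.le⟩
  have hxe : y + (1 : ℝ) • w = x := by simp [hw]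
  have hye : y + (0 : ℝ) • w = y := by simp
  simp only [hxe, hye, sub_zero, div_one] at hte
  rw [← map_sub, ← hd, hL, hL] at hte
  set v := (F (y + t • w)).mulVec w with hv
  have hsym : v ⬝ᵥ P.mulVec d = d ⬝ᵥ P.mulVec v := by
    have hT : Pᵀ = P := by simpa using hP.isHermitian.eq
    rw [dotProduct_mulVec v P d, ← mulVec_transpose, hT, dotProduct_comm]
  have h1 := hP.posSemidef.dotProduct_mulVec_nonneg (d - v)
  have h2 := (hLMI _ hz).dotProduct_mulVec_nonneg w
  have h3 : w ⬝ᵥ ((F (y + t • w))ᵀ * P * F (y + t • w)).mulVec w = v ⬝ᵥ P.mulVec v := by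
    rw [← mulVec_mulVec, ← mulVec_mulVec, ← hv, dotProduct_mulVec, vecMul_transpose]
  simp only [star_trivial, mulVec_sub, dotProduct_sub, sub_dotProduct] at h1
  simp only [star_trivial, sub_mulVec, dotProduct_sub, smul_mulVec, dotProduct_smul,
    smul_eq_mul, h3] at h2
  linarith

/-- Contraction in the `P`-norm `|x|_P = √(xᵀPx)` from the Loewner-order LMI
`F_k(x)ᵀ P F_k(x) ⪯ α² P` on a convex forward invariant set. -/
theorem stmt_1
    {n : ℕ} (P : Matrix (Fin n) (Fin n) ℝ) (hP : P.PosDef)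
    (f : ℕ → (Fin n → ℝ) → (Fin n → ℝ))
    (F : ℕ → (Fin n → ℝ) → Matrix (Fin n) (Fin n) ℝ)
    (hF : ∀ k x, HasFDerivAt (f k) ((F k x).mulVecLin.toContinuousLinearMap) x)
    (C : Set (Fin n → ℝ)) (hC : Convex ℝ C)
    (hinv : ∀ k, ∀ x ∈ C, f k x ∈ C)
    (α : ℝ) (hα : 0 ≤ α)
    (hLMI : ∀ k, ∀ x ∈ C, ((α ^ 2 • P) - (F k x)ᵀ * P * (F k x)).PosSemidef)
    (k₀ : ℕ) (x₀ y₀ : Fin n → ℝ) (hx₀ : x₀ ∈ C) (hy₀ : y₀ ∈ C)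
    (φ ψ : ℕ → (Fin n → ℝ))
    (hφ0 : φ k₀ = x₀) (hψ0 : ψ k₀ = y₀)
    (hφ : ∀ k, k₀ ≤ k → φ (k + 1) = f k (φ k))
    (hψ : ∀ k, k₀ ≤ k → ψ (k + 1) = f k (ψ k)) :
    ∀ k, k₀ ≤ k →
      Real.sqrt ((φ k - ψ k) ⬝ᵥ P.mulVec (φ k - ψ k)) ≤
        α ^ (k - k₀) * Real.sqrt ((x₀ - y₀) ⬝ᵥ P.mulVec (x₀ - y₀)) := by
  have hmem : ∀ k, k₀ ≤ k → φ k ∈ C ∧ ψ k ∈ C := by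
    intro k hk
    induction k, hk using Nat.le_induction with
    | base => exact ⟨hφ0 ▸ hx₀, hψ0 ▸ hy₀⟩
    | succ k hk ih =>
      rw [hφ k hk, hψ k hk]
      exact ⟨hinv k _ ih.1, hinv k _ ih.2⟩
  intro k hk
  induction k, hk using Nat.le_induction with
  | base => simp [hφ0, hψ0]
  | succ k hk ih =>
    have h := one_step_aux P hP (f k) (F k) (hF k) C hC α (hLMI k) (φ k) (ψ k)
      (hmem k hk).1 (hmem k hk).2
    rw [← hφ k hk, ← hψ k hk] at h
    have h' := Real.sqrt_le_sqrt h
    rw [Real.sqrt_mul (sq_nonneg α), Real.sqrt_sq hα] at h'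
    refine h'.trans ?_
    rw [Nat.succ_sub hk, pow_succ', mul_assoc]
    exact mul_le_mul_of_nonneg_left ih hα
end

section
/- Let X = ℝⁿ and Z = ℝ^{n'} be equipped with norms |·|_X and |·|_Z. Consider the cascade system x_{k+1} = f_k(x_k), z_{k+1} = g_k(x_k, z_k), where all f_k and g_k are differentiable. Let C ⊆ X and C' ⊆ Z be convex sets such that C × C' is forward invariant for the cascade, and suppose: ‖∂f_k/∂x (x)‖_X ≤ α for all x ∈ C, k ∈ ℕ; ‖∂g_k/∂z (x,z)‖_Z ≤ β and ‖∂g_k/∂x (x,z)‖_{X,Z} ≤ K (induced operator norms) for all x ∈ C, z ∈ C', k ∈ ℕ. Then for any ρ > 0, with γ = max{α + K/ρ, β}, any two trajectories of the cascade starting at time k₀ from (x₀, z₀) and (x̃₀, z̃₀) in C × C' satisfy ρ|x_k − x̃_k|_X + |z_k − z̃_k|_Z ≤ γ^{k−k₀} (ρ|x₀ − x̃₀|_X + |z₀ − z̃₀|_Z) for all k ≥ k₀. -/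
/-- Contraction of a cascade system `x_{k+1} = f_k(x_k)`, `z_{k+1} = g_k(x_k, z_k)`
in the weighted norm `ρ|x|_X + |z|_Z`, with rate `γ = max {α + K/ρ, β}`. -/
theorem stmt_4
    {X Z : Type*} [NormedAddCommGroup X] [NormedSpace ℝ X] [FiniteDimensional ℝ X]
    [NormedAddCommGroup Z] [NormedSpace ℝ Z] [FiniteDimensional ℝ Z]
    (f : ℕ → X → X) (g : ℕ → X × Z → Z)
    (hf : ∀ k, Differentiable ℝ (f k)) (hg : ∀ k, Differentiable ℝ (g k))
    (C : Set X) (C' : Set Z) (hC : Convex ℝ C) (hC' : Convex ℝ C')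
    (hinv : ∀ k, ∀ x ∈ C, ∀ z ∈ C', f k x ∈ C ∧ g k (x, z) ∈ C')
    (α β K : ℝ)
    (hα : ∀ k, ∀ x ∈ C, ‖fderiv ℝ (f k) x‖ ≤ α)
    (hβ : ∀ k, ∀ x ∈ C, ∀ z ∈ C',
      ‖(fderiv ℝ (g k) (x, z)).comp (ContinuousLinearMap.inr ℝ X Z)‖ ≤ β)
    (hK : ∀ k, ∀ x ∈ C, ∀ z ∈ C',
      ‖(fderiv ℝ (g k) (x, z)).comp (ContinuousLinearMap.inl ℝ X Z)‖ ≤ K)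
    (ρ : ℝ) (hρ : 0 < ρ)
    (k₀ : ℕ) (x x' : ℕ → X) (z z' : ℕ → Z)
    (hx₀ : x k₀ ∈ C) (hx'₀ : x' k₀ ∈ C) (hz₀ : z k₀ ∈ C') (hz'₀ : z' k₀ ∈ C')
    (hx : ∀ k, k₀ ≤ k → x (k + 1) = f k (x k))
    (hx' : ∀ k, k₀ ≤ k → x' (k + 1) = f k (x' k))
    (hz : ∀ k, k₀ ≤ k → z (k + 1) = g k (x k, z k))
    (hz' : ∀ k, k₀ ≤ k → z' (k + 1) = g k (x' k, z' k)) :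
    ∀ k, k₀ ≤ k →
      ρ * ‖x k - x' k‖ + ‖z k - z' k‖ ≤
        max (α + K / ρ) β ^ (k - k₀) * (ρ * ‖x k₀ - x' k₀‖ + ‖z k₀ - z' k₀‖) := by
  have hγ0 : 0 ≤ max (α + K / ρ) β :=
    le_max_of_le_right ((norm_nonneg _).trans (hβ 0 _ hx₀ _ hz₀))
  have step : ∀ k, ∀ a ∈ C, ∀ a' ∈ C, ∀ b ∈ C', ∀ b' ∈ C',
      ρ * ‖f k a - f k a'‖ + ‖g k (a, b) - g k (a', b')‖ ≤
        max (α + K / ρ) β * (ρ * ‖a - a'‖ + ‖b - b'‖) := by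
    intro k a ha a' ha' b hb b' hb'
    have h1 : ‖f k a - f k a'‖ ≤ α * ‖a - a'‖ :=
      hC.norm_image_sub_le_of_norm_hasFDerivWithin_le
        (fun y _ => (hf k y).hasFDerivAt.hasFDerivWithinAt) (hα k) ha' ha
    have h2 : ‖g k (a, b) - g k (a', b)‖ ≤ K * ‖a - a'‖ :=
      hC.norm_image_sub_le_of_norm_hasFDerivWithin_le (f := fun y => g k (y, b))
        (fun y _ => ((hg k (y, b)).hasFDerivAt.comp y
          (hasFDerivAt_prodMk_left y b)).hasFDerivWithinAt)
        (fun y hy => hK k y hy b hb) ha' ha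
    have h3 : ‖g k (a', b) - g k (a', b')‖ ≤ β * ‖b - b'‖ :=
      hC'.norm_image_sub_le_of_norm_hasFDerivWithin_le (f := fun y => g k (a', y))
        (fun y _ => ((hg k (a', y)).hasFDerivAt.comp y
          (hasFDerivAt_prodMk_right a' y)).hasFDerivWithinAt)
        (fun y hy => hβ k a' ha' y hy) hb' hb
    have h4 := norm_sub_le_norm_sub_add_norm_sub (g k (a, b)) (g k (a', b)) (g k (a', b'))
    have h5 := mul_le_mul_of_nonneg_left h1 hρ.le
    have h6 := mul_le_mul_of_nonneg_right (le_max_left (α + K / ρ) β)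
      (mul_nonneg hρ.le (norm_nonneg (a - a')))
    have h7 := mul_le_mul_of_nonneg_right (le_max_right (α + K / ρ) β) (norm_nonneg (b - b'))
    have h8 : (α + K / ρ) * (ρ * ‖a - a'‖) = ρ * (α * ‖a - a'‖) + K * ‖a - a'‖ := by
      field_simp
    rw [mul_add]
    linarith
  have main : ∀ k, k₀ ≤ k → (x k ∈ C ∧ x' k ∈ C ∧ z k ∈ C' ∧ z' k ∈ C') ∧
      ρ * ‖x k - x' k‖ + ‖z k - z' k‖ ≤
        max (α + K / ρ) β ^ (k - k₀) * (ρ * ‖x k₀ - x' k₀‖ + ‖z k₀ - z' k₀‖) := by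
    intro k hk
    induction k, hk using Nat.le_induction with
    | base => exact ⟨⟨hx₀, hx'₀, hz₀, hz'₀⟩, by simp⟩
    | succ k hk ih =>
      obtain ⟨⟨i1, i2, i3, i4⟩, ih⟩ := ih
      rw [hx k hk, hx' k hk, hz k hk, hz' k hk]
      refine ⟨⟨(hinv k _ i1 _ i3).1, (hinv k _ i2 _ i4).1, (hinv k _ i1 _ i3).2,
        (hinv k _ i2 _ i4).2⟩, (step k _ i1 _ i2 _ i3 _ i4).trans ?_⟩
      rw [Nat.succ_sub hk, pow_succ', mul_assoc]
      exact mul_le_mul_of_nonneg_left ih hγ0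
  exact fun k hk => (main k hk).2
end

section
/- Let X = ℝⁿ with norm |·|_X. Consider a system x̄_{k+1} = f_k(x̄_k) and a perturbed system x_{k+1} = f_k(x_k) + d_k(x_k), where all f_k and d_k are differentiable. Suppose there exist k₀ ∈ ℕ and constants K ≥ 0, α ≥ 0 such that d_k(x) = 0 for all k < k₀ and |d_k(x_k)|_X ≤ K α^{k−k₀} along the perturbed trajectory for all k ≥ k₀. Fix ρ > 0 and let γ = max{α + K/ρ, β}. Suppose C ⊆ X is a convex set forward invariant for both systems, and that the contraction condition ‖∂f_k/∂x(x) + (p/γ^{k−k₀}) ∂d_k/∂x(x)‖_X ≤ β holds for all p ∈ [0,1], all x ∈ C, and all k ≥ k₀. Then for initial conditions x₀, x̄₀ ∈ C at time k₀, the trajectories x_k of the perturbed system and x̄_k of the unperturbed system satisfy |x_k − x̄_k|_X ≤ ρ(γ^{k−k₀} − α^{k−k₀}) + γ^{k−k₀}|x₀ − x̄₀|_X for all k ≥ k₀. -/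
/-- Robustness of a contracting system to geometrically vanishing perturbations:
if `|d_k(x_k)| ≤ K α^{k-k₀}` and the interpolated Jacobians are bounded by `β`,
then with `γ = max {α + K/ρ, β}` the perturbed and unperturbed trajectories satisfy
`|x_k − x̄_k| ≤ ρ(γ^{k-k₀} − α^{k-k₀}) + γ^{k-k₀}|x₀ − x̄₀|`. -/
theorem stmt_5
    {X : Type*} [NormedAddCommGroup X] [NormedSpace ℝ X] [FiniteDimensional ℝ X]
    (f d : ℕ → X → X)
    (hf : ∀ k, Differentiable ℝ (f k)) (hd : ∀ k, Differentiable ℝ (d k))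
    (k₀ : ℕ) (K α β ρ : ℝ) (hK : 0 ≤ K) (hα : 0 ≤ α) (hρ : 0 < ρ)
    (hd0 : ∀ k < k₀, ∀ x, d k x = 0)
    (C : Set X) (hC : Convex ℝ C)
    (hinv : ∀ k, ∀ x ∈ C, f k x ∈ C)
    (hinv' : ∀ k, ∀ x ∈ C, f k x + d k x ∈ C)
    (hcontr : ∀ p ∈ Set.Icc (0 : ℝ) 1, ∀ x ∈ C, ∀ k, k₀ ≤ k →
      ‖fderiv ℝ (f k) x +
          (p / (max (α + K / ρ) β) ^ (k - k₀)) • fderiv ℝ (d k) x‖ ≤ β)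
    (x xbar : ℕ → X) (hx₀ : x k₀ ∈ C) (hxbar₀ : xbar k₀ ∈ C)
    (hx : ∀ k, k₀ ≤ k → x (k + 1) = f k (x k) + d k (x k))
    (hxbar : ∀ k, k₀ ≤ k → xbar (k + 1) = f k (xbar k))
    (hdbound : ∀ k, k₀ ≤ k → ‖d k (x k)‖ ≤ K * α ^ (k - k₀)) :
    ∀ k, k₀ ≤ k →
      ‖x k - xbar k‖ ≤
        ρ * ((max (α + K / ρ) β) ^ (k - k₀) - α ^ (k - k₀)) +
          (max (α + K / ρ) β) ^ (k - k₀) * ‖x k₀ - xbar k₀‖ := by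
  have hlip : ∀ k, k₀ ≤ k → ∀ a ∈ C, ∀ b ∈ C, ‖f k b - f k a‖ ≤ β * ‖b - a‖ := by
    intro k hk a ha b hb
    refine hC.norm_image_sub_le_of_norm_fderiv_le (𝕜 := ℝ) (fun y _ => hf k y) ?_ ha hb
    intro y hy
    have h := hcontr 0 (by simp) y hy k hk
    simpa using h
  have hxC : ∀ j, x (k₀ + j) ∈ C := by
    intro j
    induction j with
    | zero => exact hx₀
    | succ j ih =>
      rw [← Nat.add_assoc, hx _ (by omega)]
      exact hinv' _ _ ih
  have hxbC : ∀ j, xbar (k₀ + j) ∈ C := by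
    intro j
    induction j with
    | zero => exact hxbar₀
    | succ j ih =>
      rw [← Nat.add_assoc, hxbar _ (by omega)]
      exact hinv _ _ ih
  have h1 : α + K / ρ ≤ max (α + K / ρ) β := le_max_left _ _
  have hβ : β ≤ max (α + K / ρ) β := le_max_right _ _
  generalize max (α + K / ρ) β = γ at h1 hβ ⊢
  have hKρ : 0 ≤ K / ρ := by positivity
  have hγ : 0 ≤ γ := by linarith
  have hKγ : K ≤ ρ * (γ - α) := by
    have : K / ρ ≤ γ - α := by linarith
    rw [div_le_iff₀ hρ] at this
    linarith
  intro k hk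
  obtain ⟨j, rfl⟩ := Nat.exists_eq_add_of_le hk
  clear hk
  simp only [Nat.add_sub_cancel_left]
  induction j with
  | zero => simp
  | succ j ih =>
    have hk : k₀ ≤ k₀ + j := by omega
    have hdb := hdbound _ hk
    rw [Nat.add_sub_cancel_left] at hdb
    have hl := hlip _ hk _ (hxbC j) _ (hxC j)
    rw [← Nat.add_assoc, hx _ hk, hxbar _ hk]
    have htri : ‖f (k₀ + j) (x (k₀ + j)) + d (k₀ + j) (x (k₀ + j)) - f (k₀ + j) (xbar (k₀ + j))‖
        ≤ ‖f (k₀ + j) (x (k₀ + j)) - f (k₀ + j) (xbar (k₀ + j))‖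
          + ‖d (k₀ + j) (x (k₀ + j))‖ := by
      rw [add_sub_right_comm]
      exact norm_add_le _ _
    have h2 := mul_le_mul_of_nonneg_right hβ (norm_nonneg (x (k₀ + j) - xbar (k₀ + j)))
    have h3 := mul_le_mul_of_nonneg_left ih hγ
    have h4 := mul_le_mul_of_nonneg_right hKγ (pow_nonneg hα j)
    rw [pow_succ, pow_succ]
    linarith
end

section
/- Consider the observer z_{k+1} = f_k(z_k) + L_k(y_k − g_k(z_k)) on X = ℝⁿ with measurements in Y = ℝᵐ, where f_k and g_k are differentiable and L_k are n×m gain matrices. Let y and ỹ be two measurement signals that are adjacent, i.e., there is k₀ ≥ 0 with y_k = ỹ_k for k < k₀ and |y_k − ỹ_k|_Y ≤ K α^{k−k₀} for k ≥ k₀, where K > 0 and 0 ≤ α < 1. Let K' = K · sup_k ‖L_k‖_{Y,X}, and suppose ‖F_k(z) − L_k G_k(z)‖_X ≤ β for all z ∈ C and all k ∈ ℕ, where F_k and G_k are the Jacobians of f_k and g_k and C ⊆ X is a convex set forward invariant for the observer driven by y and for the observer driven by ỹ. Then for the trajectories z_k and z̃_k of the observer driven by y and ỹ respectively, with the same initial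 condition z₀ = z̃₀ ∈ C, and for any ρ > 0 with γ = max{α + K'/ρ, β}: z_k = z̃_k for all k ≤ k₀, and |z_k − z̃_k|_X ≤ ρ(γ^{k−k₀} − α^{k−k₀}) for all k > k₀. -/
/-- Sensitivity bound for a contracting Luenberger observer
`z_{k+1} = f_k(z_k) + L_k(y_k − g_k(z_k))` driven by two adjacent measurement
signals: with `K' = K · sup_k ‖L_k‖` and `γ = max {α + K'/ρ, β}`, the two observer
trajectories coincide up to time `k₀` and thereafter differ by at most
`ρ(γ^{k−k₀} − α^{k−k₀})`. -/
theorem stmt_6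
    {X Y : Type*} [NormedAddCommGroup X] [NormedSpace ℝ X] [FiniteDimensional ℝ X]
    [NormedAddCommGroup Y] [NormedSpace ℝ Y] [FiniteDimensional ℝ Y]
    (f : ℕ → X → X) (g : ℕ → X → Y)
    (hf : ∀ k, Differentiable ℝ (f k)) (hg : ∀ k, Differentiable ℝ (g k))
    (L : ℕ → Y →L[ℝ] X) (hL : BddAbove (Set.range fun k => ‖L k‖))
    (y ytil : ℕ → Y) (K α : ℝ) (hK : 0 < K) (hα0 : 0 ≤ α) (hα1 : α < 1)
    (k₀ : ℕ)
    (hadj1 : ∀ k < k₀, y k = ytil k)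
    (hadj2 : ∀ k, k₀ ≤ k → ‖y k - ytil k‖ ≤ K * α ^ (k - k₀))
    (K' : ℝ) (hK' : K' = K * ⨆ k, ‖L k‖)
    (β : ℝ) (C : Set X) (hC : Convex ℝ C)
    (hcontr : ∀ k, ∀ z ∈ C,
      ‖fderiv ℝ (f k) z - (L k).comp (fderiv ℝ (g k) z)‖ ≤ β)
    (hinv : ∀ k, ∀ x ∈ C, f k x + L k (y k - g k x) ∈ C)
    (hinv' : ∀ k, ∀ x ∈ C, f k x + L k (ytil k - g k x) ∈ C)
    (z ztil : ℕ → X) (hz0 : z 0 = ztil 0) (hz0C : z 0 ∈ C)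
    (hz : ∀ k, z (k + 1) = f k (z k) + L k (y k - g k (z k)))
    (hztil : ∀ k, ztil (k + 1) = f k (ztil k) + L k (ytil k - g k (ztil k)))
    (ρ : ℝ) (hρ : 0 < ρ) :
    (∀ k ≤ k₀, z k = ztil k) ∧
      ∀ k, k₀ < k →
        ‖z k - ztil k‖ ≤
          ρ * ((max (α + K' / ρ) β) ^ (k - k₀) - α ^ (k - k₀)) := by
  have hzC : ∀ k, z k ∈ C := by
    intro k
    induction k with
    | zero => exact hz0C
    | succ k ih => rw [hz]; exact hinv k _ ih
  have hztC : ∀ k, ztil k ∈ C := by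
    intro k
    induction k with
    | zero => rw [← hz0]; exact hz0C
    | succ k ih => rw [hztil]; exact hinv' k _ ih
  have h1 : ∀ k ≤ k₀, z k = ztil k := by
    intro k
    induction k with
    | zero => intro _; exact hz0
    | succ k ih =>
      intro hk
      rw [hz, hztil, ih (by omega), hadj1 k (by omega)]
  refine ⟨h1, ?_⟩
  have hmv : ∀ k, ‖(f k (z k) - L k (g k (z k))) - (f k (ztil k) - L k (g k (ztil k)))‖
      ≤ β * ‖z k - ztil k‖ := by
    intro k
    have hd : ∀ x ∈ C, HasFDerivWithinAt (fun x => f k x - L k (g k x))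
        (fderiv ℝ (f k) x - (L k).comp (fderiv ℝ (g k) x)) C x := by
      intro x _
      exact ((hf k x).hasFDerivAt.sub
        ((L k).hasFDerivAt.comp x (hg k x).hasFDerivAt)).hasFDerivWithinAt
    exact hC.norm_image_sub_le_of_norm_hasFDerivWithin_le hd (hcontr k) (hztC k) (hzC k)
  set γ := max (α + K' / ρ) β with hγ
  have hS0 : 0 ≤ ⨆ k, ‖L k‖ := Real.iSup_nonneg fun k => norm_nonneg _
  have hK'0 : 0 ≤ K' := by rw [hK']; positivity
  have hγ1 : α + K' / ρ ≤ γ := le_max_left _ _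
  have hγβ : β ≤ γ := le_max_right _ _
  have hq : 0 ≤ K' / ρ := by positivity
  have hγ0 : 0 ≤ γ := by linarith
  have hKρ : K' ≤ ρ * (γ - α) := by
    have : K' / ρ ≤ γ - α := by linarith
    rw [div_le_iff₀ hρ] at this
    linarith
  have main : ∀ d, ‖z (k₀ + d) - ztil (k₀ + d)‖ ≤ ρ * (γ ^ d - α ^ d) := by
    intro d
    induction d with
    | zero => simp [h1 k₀ le_rfl]
    | succ d ih =>
      have e : z (k₀ + (d + 1)) - ztil (k₀ + (d + 1)) =
          ((f (k₀ + d) (z (k₀ + d)) - L (k₀ + d) (g (k₀ + d) (z (k₀ + d))))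
            - (f (k₀ + d) (ztil (k₀ + d)) - L (k₀ + d) (g (k₀ + d) (ztil (k₀ + d)))))
          + L (k₀ + d) (y (k₀ + d) - ytil (k₀ + d)) := by
        rw [← add_assoc, hz, hztil]
        simp only [map_sub]
        abel
      have hb : ‖L (k₀ + d) (y (k₀ + d) - ytil (k₀ + d))‖ ≤ K' * α ^ d := by
        have ha := hadj2 (k₀ + d) (by omega)
        rw [Nat.add_sub_cancel_left] at ha
        calc _ ≤ ‖L (k₀ + d)‖ * ‖y (k₀ + d) - ytil (k₀ + d)‖ := (L (k₀ + d)).le_opNorm _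
          _ ≤ (⨆ k, ‖L k‖) * (K * α ^ d) :=
            mul_le_mul (le_ciSup hL (k₀ + d)) ha (norm_nonneg _) hS0
          _ = K' * α ^ d := by rw [hK']; ring
      rw [e]
      calc _ ≤ _ := norm_add_le _ _
        _ ≤ β * ‖z (k₀ + d) - ztil (k₀ + d)‖ + K' * α ^ d := add_le_add (hmv _) hb
        _ ≤ γ * (ρ * (γ ^ d - α ^ d)) + ρ * (γ - α) * α ^ d := by
          refine add_le_add ?_ (mul_le_mul_of_nonneg_right hKρ (pow_nonneg hα0 d))
          exact (mul_le_mul_of_nonneg_right hγβ (norm_nonneg _)).trans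
            (mul_le_mul_of_nonneg_left ih hγ0)
        _ = ρ * (γ ^ (d + 1) - α ^ (d + 1)) := by ring
  intro k hk
  have := main (k - k₀)
  rwa [Nat.add_sub_cancel' hk.le] at this
end

section
/- Let z, z̃ : ℕ → ℝⁿ be two sequences, let P be a real symmetric positive definite n×n matrix with norm |x|_P = √(xᵀPx), and suppose there are constants ρ > 0, 0 ≤ α ≤ γ < 1, and a time k₀ ∈ ℕ such that z_k = z̃_k for all k ≤ k₀ and |z_k − z̃_k|_P ≤ ρ(γ^{k−k₀} − α^{k−k₀}) for all k > k₀. Then (Σ_{k=0}^∞ |z_k − z̃_k|_P²)^{1/2} ≤ ρ B, where B = (Σ_{j=0}^∞ (γ^j − α^j)²)^{1/2}, and moreover ρB ≤ ρ/√(1−γ²). -/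
open Matrix

/-- ℓ²-sensitivity bound in the `|·|_P` norm for the output-perturbation mechanism:
`(Σ_k |z_k − z̃_k|_P²)^{1/2} ≤ ρB` with `B = (Σ_j (γ^j − α^j)²)^{1/2}`, and
`ρB ≤ ρ/√(1−γ²)`. -/
theorem stmt_10
    {n : ℕ} (z ztil : ℕ → Fin n → ℝ)
    (P : Matrix (Fin n) (Fin n) ℝ) (hP : P.PosDef)
    (ρ α γ : ℝ) (hρ : 0 < ρ)
    (hα0 : 0 ≤ α) (hαγ : α ≤ γ) (hγ1 : γ < 1) (k₀ : ℕ)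
    (h1 : ∀ k ≤ k₀, z k = ztil k)
    (h2 : ∀ k, k₀ < k →
      Real.sqrt ((z k - ztil k) ⬝ᵥ P.mulVec (z k - ztil k)) ≤
        ρ * (γ ^ (k - k₀) - α ^ (k - k₀))) :
    Real.sqrt (∑' k, (Real.sqrt ((z k - ztil k) ⬝ᵥ P.mulVec (z k - ztil k))) ^ 2) ≤
        ρ * Real.sqrt (∑' j, (γ ^ j - α ^ j) ^ 2) ∧
      ρ * Real.sqrt (∑' j, (γ ^ j - α ^ j) ^ 2) ≤ ρ / Real.sqrt (1 - γ ^ 2) := by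
  have hγ0 : 0 ≤ γ := hα0.trans hαγ
  have hγ2 : γ ^ 2 < 1 := by nlinarith
  have hgeo : HasSum (fun j : ℕ => (γ ^ 2) ^ j) (1 - γ ^ 2)⁻¹ :=
    hasSum_geometric_of_lt_one (sq_nonneg γ) hγ2
  have hdiff : ∀ j : ℕ, 0 ≤ γ ^ j - α ^ j := fun j =>
    sub_nonneg.2 (pow_le_pow_left₀ hα0 hαγ j)
  have hle : ∀ j : ℕ, (γ ^ j - α ^ j) ^ 2 ≤ (γ ^ 2) ^ j := by
    intro j
    rw [← pow_mul, mul_comm 2 j, pow_mul]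
    have h0 : 0 ≤ α ^ j := pow_nonneg hα0 j
    exact pow_le_pow_left₀ (hdiff j) (by linarith) 2
  have hsum : Summable (fun j : ℕ => (γ ^ j - α ^ j) ^ 2) :=
    Summable.of_nonneg_of_le (fun j => sq_nonneg _) hle hgeo.summable
  constructor
  · set f : ℕ → ℝ := fun k =>
      (Real.sqrt ((z k - ztil k) ⬝ᵥ P.mulVec (z k - ztil k))) ^ 2 with hf
    have hf0 : ∀ k ≤ k₀, f k = 0 := by
      intro k hk
      simp [hf, h1 k hk]
    have hfle : ∀ j, f (j + k₀) ≤ ρ ^ 2 * (γ ^ j - α ^ j) ^ 2 := by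
      intro j
      rcases Nat.eq_zero_or_pos j with rfl | hj
      · rw [hf0 _ (by omega)]
        positivity
      · have h := h2 (j + k₀) (by omega)
        rw [Nat.add_sub_cancel] at h
        rw [← mul_pow]
        exact pow_le_pow_left₀ (Real.sqrt_nonneg _) h 2
    have hs' : Summable (fun j => f (j + k₀)) :=
      Summable.of_nonneg_of_le (fun j => sq_nonneg _) hfle (hsum.mul_left _)
    have hs : Summable f := (summable_nat_add_iff k₀).1 hs'
    have hz : ∑ i ∈ Finset.range k₀, f i = 0 :=
      Finset.sum_eq_zero fun i hi => hf0 i (Finset.mem_range.1 hi).le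
    have ht : ∑' k, f k ≤ ρ ^ 2 * ∑' j, (γ ^ j - α ^ j) ^ 2 := by
      rw [← hs.sum_add_tsum_nat_add k₀, hz, zero_add, ← tsum_mul_left]
      exact hs'.tsum_le_tsum hfle (hsum.mul_left _)
    calc Real.sqrt (∑' k, f k) ≤ Real.sqrt (ρ ^ 2 * ∑' j, (γ ^ j - α ^ j) ^ 2) :=
          Real.sqrt_le_sqrt ht
      _ = _ := by rw [Real.sqrt_mul (sq_nonneg ρ), Real.sqrt_sq hρ.le]
  · rw [div_eq_mul_inv, ← Real.sqrt_inv, ← hgeo.tsum_eq]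
    exact mul_le_mul_of_nonneg_left
      (Real.sqrt_le_sqrt (hsum.tsum_le_tsum hle hgeo.summable)) hρ.le
end

section
/- Let a ≥ 0 and set b = e^{−a}/(1 + e^{−a})². Let f, β, l be real numbers with β ≥ 0, l ≥ 0, and suppose (f − β)/b ≤ l (equivalently f − β ≤ l·b) and l ≤ 4(f + β). Then for every z ∈ [−a, a], −β ≤ f − l · e^{−z}/(1 + e^{−z})² ≤ β; i.e., the scalar observer z_{k+1} = f z_k + l(y_k − 1/(1 + e^{−z_k})) has Jacobian bounded in absolute value by β on [−a, a], so it is β-contracting there. -/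
/-- Contraction of the scalar blockmodel observer: if `(f − β)/b ≤ l ≤ 4(f + β)`
with `b = e^{−a}/(1+e^{−a})²`, then the Jacobian `f − l·e^{−z}/(1+e^{−z})²` is
bounded in absolute value by `β` on `[−a, a]`. -/
theorem stmt_15 (a : ℝ) (ha : 0 ≤ a)
    (f β l : ℝ) (hβ : 0 ≤ β) (hl : 0 ≤ l)
    (hlb : f - β ≤ l * (Real.exp (-a) / (1 + Real.exp (-a)) ^ 2))
    (hub : l ≤ 4 * (f + β)) :
    ∀ z ∈ Set.Icc (-a) a,
      -β ≤ f - l * (Real.exp (-z) / (1 + Real.exp (-z)) ^ 2) ∧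
        f - l * (Real.exp (-z) / (1 + Real.exp (-z)) ^ 2) ≤ β := by
  rintro z ⟨hz1, hz2⟩
  have hx : 0 < Real.exp (-a) := Real.exp_pos _
  have hy : 0 < Real.exp (-z) := Real.exp_pos _
  have hxy : Real.exp (-a) ≤ Real.exp (-z) := Real.exp_le_exp.mpr (by linarith)
  have hxy1 : Real.exp (-a) * Real.exp (-z) ≤ 1 := by
    rw [← Real.exp_add]
    exact Real.exp_le_one_iff.mpr (by linarith)
  generalize Real.exp (-a) = x at *
  generalize Real.exp (-z) = y at *
  have h1 : y / (1 + y) ^ 2 ≤ 1 / 4 := by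
    rw [div_le_div_iff₀ (by positivity) (by norm_num)]
    nlinarith [sq_nonneg (1 - y)]
  have h2 : x / (1 + x) ^ 2 ≤ y / (1 + y) ^ 2 := by
    rw [div_le_div_iff₀ (by positivity) (by positivity)]
    nlinarith [mul_nonneg (sub_nonneg.mpr hxy) (sub_nonneg.mpr hxy1)]
  have h3 := mul_le_mul_of_nonneg_left h1 hl
  have h4 := mul_le_mul_of_nonneg_left h2 hl
  constructor <;> linarith
end
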